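/- If R₁ and R₂ are Phan residues in C_ε of types I₁ and I₂ respectively, and R₁ ∩ R₂ ≠ ∅, then R₁ ∩ R₂ is a Phan residue of type I₁ ∩ I₂. -/

import Mathlib

universe u v

/-- A twin building of type `(W,S)` (where `S` is the set of simple reflections of the
Coxeter system `cs`), with positive half `Cp` and negative half `Cm`, distance functions
`δp`, `δm`, codistance `δst : Cp × Cm → W`, `δts : Cm × Cp → W`, together with a
quasi-flip: maps `θp : Cp → Cm`, `θm : Cm → Cp` inverse to each other and an automorphism
`π` of `W` with `π(S) = S`, `π ∘ π = id`, compatible with the distances and the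
codistance. -/
structure QuasiFlipTwinBuilding {B : Type*} {W : Type*} [Group W]
    (M : CoxeterMatrix B) (cs : CoxeterSystem M W)
    (Cp : Type u) (Cm : Type v) where
  δp : Cp → Cp → W
  δm : Cm → Cm → W
  δst : Cp → Cm → W
  δts : Cm → Cp → W
  θp : Cp → Cm
  θm : Cm → Cp
  π : W ≃* W
  nonempty_p : Nonempty Cp
  nonempty_m : Nonempty Cm
  /-- (Bu1) for the positive half -/
  p_eq_one_iff : ∀ x y : Cp, δp x y = 1 ↔ x = y
  /-- (Bu1) for the negative half -/
  m_eq_one_iff : ∀ x y : Cm, δm x y = 1 ↔ x = y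
  /-- (Bu2) for the positive half -/
  p_two : ∀ (x y z : Cp) (s : W), s ∈ Set.range cs.simple → δp y z = s →
    δp x z = δp x y ∨ δp x z = δp x y * s
  p_two' : ∀ (x y z : Cp) (s : W), s ∈ Set.range cs.simple → δp y z = s →
    cs.length (δp x y * s) = cs.length (δp x y) + 1 → δp x z = δp x y * s
  /-- (Bu2) for the negative half -/
  m_two : ∀ (x y z : Cm) (s : W), s ∈ Set.range cs.simple → δm y z = s →
    δm x z = δm x y ∨ δm x z = δm x y * s
  m_two' : ∀ (x y z : Cm) (s : W), s ∈ Set.range cs.simple → δm y z = s →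
    cs.length (δm x y * s) = cs.length (δm x y) + 1 → δm x z = δm x y * s
  /-- (Bu3) for the positive half -/
  p_three : ∀ (x y : Cp) (s : W), s ∈ Set.range cs.simple →
    ∃ z : Cp, δp y z = s ∧ δp x z = δp x y * s
  /-- (Bu3) for the negative half -/
  m_three : ∀ (x y : Cm) (s : W), s ∈ Set.range cs.simple →
    ∃ z : Cm, δm y z = s ∧ δm x z = δm x y * s
  /-- (Tw1) -/
  tw1 : ∀ (x : Cp) (y : Cm), δts y x = (δst x y)⁻¹
  /-- (Tw2), positive-to-negative -/
  tw2p : ∀ (x : Cp) (y z : Cm) (s : W), s ∈ Set.range cs.simple → δm y z = s →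
    cs.length (δst x y * s) + 1 = cs.length (δst x y) → δst x z = δst x y * s
  /-- (Tw2), negative-to-positive -/
  tw2m : ∀ (x : Cm) (y z : Cp) (s : W), s ∈ Set.range cs.simple → δp y z = s →
    cs.length (δts x y * s) + 1 = cs.length (δts x y) → δts x z = δts x y * s
  /-- (Tw3), positive-to-negative -/
  tw3p : ∀ (x : Cp) (y : Cm) (s : W), s ∈ Set.range cs.simple →
    ∃ z : Cm, δm y z = s ∧ δst x z = δst x y * s
  /-- (Tw3), negative-to-positive -/
  tw3m : ∀ (x : Cm) (y : Cp) (s : W), s ∈ Set.range cs.simple →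
    ∃ z : Cp, δp y z = s ∧ δts x z = δts x y * s
  /-- `θ ∘ θ = id` -/
  θmθp : ∀ c : Cp, θm (θp c) = c
  θpθm : ∀ c : Cm, θp (θm c) = c
  /-- `π(S) = S` -/
  πS : ⇑π '' Set.range cs.simple = Set.range cs.simple
  /-- `π ∘ π = id` -/
  ππ : ∀ w : W, π (π w) = w
  /-- `θ` interchanges the distances via `π` -/
  flip_p : ∀ x y : Cp, δm (θp x) (θp y) = π (δp x y)
  flip_m : ∀ x y : Cm, δp (θm x) (θm y) = π (δm x y)
  /-- `θ` preserves the codistance via `π` -/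
  flip_st : ∀ (x : Cp) (z : Cm), δts (θp x) (θm z) = π (δst x z)
  flip_ts : ∀ (x : Cm) (z : Cp), δst (θm x) (θp z) = π (δts x z)

namespace QuasiFlipTwinBuilding

variable {B : Type*} {W : Type*} [Group W] {M : CoxeterMatrix B} {cs : CoxeterSystem M W}
  {Cp : Type u} {Cm : Type v}

/-- The same twin building with a quasi-flip, with the roles of the two halves
interchanged. -/
def swap (T : QuasiFlipTwinBuilding M cs Cp Cm) : QuasiFlipTwinBuilding M cs Cm Cp where
  δp := T.δm
  δm := T.δp
  δst := T.δts
  δts := T.δst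
  θp := T.θm
  θm := T.θp
  π := T.π
  nonempty_p := T.nonempty_m
  nonempty_m := T.nonempty_p
  p_eq_one_iff := T.m_eq_one_iff
  m_eq_one_iff := T.p_eq_one_iff
  p_two := T.m_two
  p_two' := T.m_two'
  m_two := T.p_two
  m_two' := T.p_two'
  p_three := T.m_three
  m_three := T.p_three
  tw1 := fun x y => by rw [T.tw1 y x, inv_inv]
  tw2p := T.tw2m
  tw2m := T.tw2p
  tw3p := T.tw3m
  tw3m := T.tw3p
  θmθp := T.θpθm
  θpθm := T.θmθp
  πS := T.πS
  ππ := T.ππ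
  flip_p := T.flip_m
  flip_m := T.flip_p
  flip_st := T.flip_ts
  flip_ts := T.flip_st

variable (T : QuasiFlipTwinBuilding M cs Cp Cm)

/-- The `θ`-codistance `δ^θ(c) = δ*(c, θ(c))` of a chamber of the positive half. -/
def δθ (c : Cp) : W := T.δst c (T.θp c)

/-- The numerical `θ`-codistance `ℓ^θ(c) = ℓ(δ^θ(c))`. -/
noncomputable def ℓθ (c : Cp) : ℕ := cs.length (T.δθ c)

/-- The `s`-panel of a chamber `c`. -/
def panel (s : W) (c : Cp) : Set Cp := {d | T.δp c d = 1 ∨ T.δp c d = s}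

/-- The `J`-residue of a chamber `c`. -/
def residue (J : Set W) (c : Cp) : Set Cp := {d | T.δp c d ∈ Subgroup.closure J}

/-- Opposition of chambers: `δ*(c,d) = 1`. -/
def Opp (c : Cp) (d : Cm) : Prop := T.δst c d = 1

/-- `R` is a Phan residue of type `J`: `R` is a `J`-residue, every chamber of `R` is
opposite some chamber of `θ(R)`, and every chamber of `θ(R)` is opposite some chamber
of `R`. -/
def IsPhan (J : Set W) (R : Set Cp) : Prop :=
  (∃ c : Cp, R = T.residue J c) ∧
  (∀ r ∈ R, ∃ r' ∈ R, T.Opp r (T.θp r')) ∧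
  (∀ r' ∈ R, ∃ r ∈ R, T.Opp r (T.θp r'))

/-- `R` is a minimal Phan residue of type `J`: it is a Phan residue containing no Phan
residue as a proper subset. -/
def IsMinPhan (J : Set W) (R : Set Cp) : Prop :=
  T.IsPhan J R ∧ ∀ (J' : Set W) (R' : Set Cp), J' ⊆ Set.range cs.simple →
    T.IsPhan J' R' → R' ⊆ R → R' = R

/-- Two chambers are `J`-adjacent: they are `j`-adjacent for some `j ∈ J`. -/
def adjJ (J : Set W) (c d : Cp) : Prop := ∃ j ∈ J, T.δp c d = 1 ∨ T.δp c d = j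

/-- There is a `J`-gallery from `c` to `d` all of whose chambers lie in `X`. -/
def GalleryIn (X : Set Cp) (J : Set W) (c d : Cp) : Prop :=
  ∃ γ : List Cp, γ.head? = some c ∧ γ.getLast? = some d ∧
    γ.Chain' (T.adjJ J) ∧ ∀ x ∈ γ, x ∈ X

/-- The flip-flop system of a set `R` of chambers: the chambers of `R` whose numerical
`θ`-codistance is minimal among chambers of `R`. -/
def flipflop (R : Set Cp) : Set Cp := {c ∈ R | ∀ d ∈ R, T.ℓθ c ≤ T.ℓθ d}

/-- The flip-flop system `R^θ` is connected: any two of its chambers are joined by a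
gallery all of whose chambers lie in `R^θ`. -/
def ConnectedFF (R : Set Cp) : Prop :=
  ∀ c ∈ T.flipflop R, ∀ d ∈ T.flipflop R,
    T.GalleryIn (T.flipflop R) (Set.range cs.simple) c d

/-- `R` admits direct descent into `R^θ`: from every chamber of `R` there is a gallery
within `R` ending in `R^θ` along which the numerical `θ`-codistance strictly decreases. -/
def DirectDescent (R : Set Cp) : Prop :=
  ∀ c ∈ R, ∃ γ : List Cp, γ.head? = some c ∧
    (∃ e, γ.getLast? = some e ∧ e ∈ T.flipflop R) ∧
    γ.Chain' (T.adjJ (Set.range cs.simple)) ∧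
    γ.Chain' (fun a b => T.ℓθ b < T.ℓθ a) ∧
    ∀ x ∈ γ, x ∈ R

/-- The quasi-flip is strong on this half: for every chamber `c` and every `s ∈ S` there
are chambers `d, x` in the `s`-panel of `c` with `ℓ(δ*(x, θ(d))) > ℓ(δ*(d, θ(d)))`,
i.e. the projection of `θ(d)` onto the panel is not `d`. -/
def IsStrongHalf : Prop :=
  ∀ (c : Cp) (s : W), s ∈ Set.range cs.simple →
    ∃ d ∈ T.panel s c, ∃ x ∈ T.panel s c,
      cs.length (T.δst d (T.θp d)) < cs.length (T.δst x (T.θp d))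

end QuasiFlipTwinBuilding

namespace CoxeterSystem

variable {B : Type*} {W : Type*} [Group W] {M : CoxeterMatrix B} (cs : CoxeterSystem M W)

open Classical in
/-- The action of a simple reflection `s i` on `W × ZMod 2`: conjugation by `s i` on the first
component, changing the sign exactly above `s i`. -/
noncomputable def signedConj (i : B) : Equiv.Perm (W × ZMod 2) :=
  Function.Involutive.toPerm
    (fun p => (cs.simple i * p.1 * cs.simple i, p.2 + if p.1 = cs.simple i then 1 else 0)) <| by
    rintro ⟨t, ε⟩
    have h : cs.simple i * t * cs.simple i = cs.simple i ↔ t = cs.simple i := by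
      constructor
      · intro h
        have := congrArg (fun x => cs.simple i * x * cs.simple i) h
        simpa [mul_assoc] using this
      · rintro rfl; simp
    ext
    · simp [mul_assoc]
    · simp only [h]
      split_ifs <;> simp [add_assoc, CharTwo.add_self_eq_zero]

open Classical in
theorem signedConj_apply (i : B) (t : W) (ε : ZMod 2) :
    cs.signedConj i (t, ε) =
      (cs.simple i * t * cs.simple i, ε + if t = cs.simple i then 1 else 0) := rfl

open Classical in
theorem signedConj_mul_pow_apply (i i' : B) (n : ℕ) (t : W) (ε : ZMod 2) :
    ((cs.signedConj i * cs.signedConj i') ^ n) (t, ε) =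
      ((cs.simple i * cs.simple i') ^ n * t * ((cs.simple i * cs.simple i') ^ n)⁻¹,
        ε + ∑ j ∈ Finset.range (2 * n),
          if t = ((cs.simple i * cs.simple i')⁻¹) ^ j * cs.simple i' then 1 else 0) := by
  induction n with
  | zero => simp
  | succ n ih =>
    set c := cs.simple i * cs.simple i' with hc
    have hconj : ∀ k : ℕ, cs.simple i' * c ^ k = (c⁻¹) ^ k * cs.simple i' := fun k => by
      induction k with
      | zero => simp
      | succ k ihk =>
        rw [pow_succ, ← mul_assoc, ihk, pow_succ, mul_assoc, mul_assoc]
        congr 1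
        simp [hc, mul_assoc]
    have hdescend : ∀ x : W, c ^ n * t * (c ^ n)⁻¹ = x ↔ t = (c⁻¹) ^ n * x * c ^ n := fun x => by
      rw [mul_inv_eq_iff_eq_mul, ← eq_inv_mul_iff_mul_eq, inv_pow, mul_assoc]
    have h₁ : c ^ n * t * (c ^ n)⁻¹ = cs.simple i' ↔ t = (c⁻¹) ^ (2 * n) * cs.simple i' := by
      rw [hdescend, mul_assoc, hconj, ← mul_assoc, ← pow_add, two_mul]
    have h₂ : cs.simple i' * (c ^ n * t * (c ^ n)⁻¹) * cs.simple i' = cs.simple i ↔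
        t = (c⁻¹) ^ (2 * n + 1) * cs.simple i' := by
      have : cs.simple i' * (c ^ n * t * (c ^ n)⁻¹) * cs.simple i' = cs.simple i ↔
          c ^ n * t * (c ^ n)⁻¹ = c⁻¹ * cs.simple i' := by
        rw [← eq_mul_inv_iff_mul_eq, ← eq_inv_mul_iff_mul_eq]
        simp [hc, mul_assoc]
      rw [this, hdescend, mul_assoc, mul_assoc, hconj, ← mul_assoc, ← mul_assoc, ← pow_succ,
        ← pow_add]
      congr! 3
      omega
    rw [pow_succ', Equiv.Perm.mul_apply, ih, Equiv.Perm.mul_apply, signedConj_apply,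
      signedConj_apply]
    ext
    · simp [pow_succ', hc, mul_assoc]
    · simp only [h₁, h₂, mul_add, mul_one, Finset.sum_range_succ, add_assoc]

theorem isLiftable_signedConj : M.IsLiftable cs.signedConj := by
  classical
  intro i i'
  ext1 ⟨t, ε⟩
  have hc : (cs.simple i * cs.simple i') ^ M i i' = 1 := cs.simple_mul_simple_pow i i'
  rw [signedConj_mul_pow_apply, hc, two_mul, Finset.sum_range_add]
  have : ∀ j, ((cs.simple i * cs.simple i')⁻¹) ^ (M i i' + j) =
      ((cs.simple i * cs.simple i')⁻¹) ^ j := fun j => by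
    rw [pow_add, inv_pow, hc, inv_one, one_mul]
  simp only [this, CharTwo.add_self_eq_zero, add_zero, one_mul, inv_one, mul_one,
    Equiv.Perm.one_apply]

/-- The signed conjugation action of `W` on `W × ZMod 2`. -/
noncomputable def signedConjHom : W →* Equiv.Perm (W × ZMod 2) :=
  cs.lift ⟨cs.signedConj, cs.isLiftable_signedConj⟩

open Classical in
theorem signedConjHom_wordProd (ω : List B) (t : W) (ε : ZMod 2) :
    cs.signedConjHom (cs.wordProd ω) (t, ε) =
      (cs.wordProd ω * t * (cs.wordProd ω)⁻¹, ε + (cs.rightInvSeq ω).count t) := by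
  induction ω with
  | nil => simp
  | cons i ω ih =>
    have h : cs.wordProd ω * t * (cs.wordProd ω)⁻¹ = cs.simple i ↔
        (cs.wordProd ω)⁻¹ * cs.simple i * cs.wordProd ω = t := by
      rw [mul_inv_eq_iff_eq_mul, ← eq_inv_mul_iff_mul_eq, mul_assoc, eq_comm]
    rw [wordProd_cons, map_mul, Equiv.Perm.mul_apply, ih,
      show cs.signedConjHom (cs.simple i) = cs.signedConj i from
        cs.lift_apply_simple cs.isLiftable_signedConj i, signedConj_apply]
    ext
    · simp [mul_assoc]
    · simp only [h, rightInvSeq, List.count_cons, beq_iff_eq, Nat.cast_add, Nat.cast_ite,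
        Nat.cast_one, Nat.cast_zero, add_assoc]

/-- The exchange condition. -/
theorem exists_wordProd_eraseIdx_of_isRightDescent {ω : List B} {i : B}
    (h : cs.IsRightDescent (cs.wordProd ω) i) :
    ∃ j < ω.length, cs.wordProd ω * cs.simple i = cs.wordProd (ω.eraseIdx j) := by
  classical
  obtain ⟨ω', hω', hω'_prod⟩ := cs.exists_isReduced (cs.wordProd ω * cs.simple i)
  have hprod : cs.wordProd (ω'.concat i) = cs.wordProd ω := by
    rw [wordProd_concat, ← hω'_prod]; simp
  have hred : cs.IsReduced (ω'.concat i) := by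
    have := cs.isRightDescent_iff.mp h
    rw [IsReduced, hprod, List.length_concat, ← hω'.eq, ← hω'_prod, this]
  have hmem : cs.simple i ∈ cs.rightInvSeq (ω'.concat i) := by
    rw [rightInvSeq_concat]; simp
  have hcount := cs.signedConjHom_wordProd (ω'.concat i) (cs.simple i) 0
  rw [hprod, signedConjHom_wordProd, List.count_eq_one_of_mem hred.nodup_rightInvSeq hmem] at hcount
  have hmem' : cs.simple i ∈ cs.rightInvSeq ω := by
    by_contra hn
    rw [List.count_eq_zero_of_not_mem hn] at hcount
    simp at hcount
  obtain ⟨j, hj, hji⟩ := List.getElem_of_mem hmem'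
  refine ⟨j, by simpa using hj, ?_⟩
  rw [← wordProd_mul_getD_rightInvSeq, List.getD_eq_getElem _ _ hj, hji]

variable {cs}

/-- Every element of a standard parabolic subgroup has a reduced word in its generators. -/
theorem exists_isReduced_of_mem_closure {J : Set W} (hJ : J ⊆ Set.range cs.simple) {w : W}
    (hw : w ∈ Subgroup.closure J) :
    ∃ ω : List B, cs.IsReduced ω ∧ w = cs.wordProd ω ∧ ∀ i ∈ ω, cs.simple i ∈ J := by
  have step : ∀ w s, s ∈ J →
      (∃ ω : List B, cs.IsReduced ω ∧ w = cs.wordProd ω ∧ ∀ i ∈ ω, cs.simple i ∈ J) →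
      ∃ ω : List B, cs.IsReduced ω ∧ w * s = cs.wordProd ω ∧ ∀ i ∈ ω, cs.simple i ∈ J := by
    rintro w s hs ⟨ω, hω, rfl, hωJ⟩
    obtain ⟨i, rfl⟩ := hJ hs
    by_cases h : cs.IsRightDescent (cs.wordProd ω) i
    · obtain ⟨j, hj, hj'⟩ := cs.exists_wordProd_eraseIdx_of_isRightDescent h
      refine ⟨_, ?_, hj', fun k hk => hωJ k (List.mem_of_mem_eraseIdx hk)⟩
      have h₁ := cs.isRightDescent_iff.mp h
      have h₂ := List.length_eraseIdx_add_one hj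
      rw [IsReduced, ← hj']
      rw [hω.eq] at h₁
      omega
    · refine ⟨ω.concat i, ?_, (cs.wordProd_concat i ω).symm, ?_⟩
      · rw [IsReduced, wordProd_concat, cs.not_isRightDescent_iff.mp h, hω.eq, List.length_concat]
      · intro k hk
        rw [List.concat_eq_append, List.mem_append, List.mem_singleton] at hk
        rcases hk with hk | rfl
        exacts [hωJ k hk, hs]
  induction hw using Subgroup.closure_induction_right with
  | one => exact ⟨[], by simp [IsReduced], by simp, by simp⟩
  | mul_right w _ s hs ih => exact step w s hs ih
  | mul_inv_cancel w _ s hs ih =>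
    obtain ⟨i, rfl⟩ := hJ hs
    simpa using step w _ hs ih

theorem simple_mem_of_mem_closure {J : Set W} (hJ : J ⊆ Set.range cs.simple) {i : B}
    (hi : cs.simple i ∈ Subgroup.closure J) : cs.simple i ∈ J := by
  obtain ⟨ω, hω, hprod, hωJ⟩ := exists_isReduced_of_mem_closure hJ hi
  have hlen := hω.eq
  rw [← hprod, length_simple] at hlen
  obtain ⟨k, rfl⟩ := List.length_eq_one_iff.mp hlen.symm
  rw [hprod, wordProd_singleton]
  exact hωJ k (by simp)

theorem simple_mem_of_isRightDescent {J : Set W} (hJ : J ⊆ Set.range cs.simple) {w : W}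
    (hw : w ∈ Subgroup.closure J) {i : B} (hi : cs.IsRightDescent w i) : cs.simple i ∈ J := by
  obtain ⟨ω, hω, rfl, hωJ⟩ := exists_isReduced_of_mem_closure hJ hw
  obtain ⟨j, hj, hj'⟩ := cs.exists_wordProd_eraseIdx_of_isRightDescent hi
  refine simple_mem_of_mem_closure hJ ?_
  rw [← inv_mul_cancel_left (cs.wordProd ω) (cs.simple i), hj']
  refine mul_mem (inv_mem hw) (Subgroup.list_prod_mem _ fun x hx => ?_)
  obtain ⟨k, hk, rfl⟩ := List.mem_map.mp hx
  exact Subgroup.subset_closure (hωJ k (List.mem_of_mem_eraseIdx hk))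

/-- The intersection of two standard parabolic subgroups is the standard parabolic subgroup of
the intersection of their types. -/
theorem closure_inter {I J : Set W} (hI : I ⊆ Set.range cs.simple)
    (hJ : J ⊆ Set.range cs.simple) :
    Subgroup.closure (I ∩ J) = Subgroup.closure I ⊓ Subgroup.closure J := by
  refine le_antisymm (le_inf (Subgroup.closure_mono Set.inter_subset_left)
    (Subgroup.closure_mono Set.inter_subset_right)) fun w hw => ?_
  induction hn : cs.length w using Nat.strong_induction_on generalizing w with
  | _ n ih =>
    obtain rfl | hne := eq_or_ne w 1
    · exact one_mem _
    obtain ⟨i, hi⟩ := cs.exists_rightDescent_of_ne_one hne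
    have hiI := simple_mem_of_isRightDescent hI hw.1 hi
    have hiJ := simple_mem_of_isRightDescent hJ hw.2 hi
    have hrec := ih _ (hn ▸ hi) (w * cs.simple i)
      ⟨mul_mem hw.1 (Subgroup.subset_closure hiI), mul_mem hw.2 (Subgroup.subset_closure hiJ)⟩ rfl
    rw [← cs.simple_mul_simple_cancel_right (w := w) i]
    exact mul_mem hrec (Subgroup.subset_closure ⟨hiI, hiJ⟩)

end CoxeterSystem

namespace QuasiFlipTwinBuilding

variable {B : Type*} {W : Type*} [Group W] {M : CoxeterMatrix B} {cs : CoxeterSystem M W}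
  {Cp : Type u} {Cm : Type v} (T : QuasiFlipTwinBuilding M cs Cp Cm)
  {J : Set W}

theorem simple_mul_self_of_mem_range {s : W} (hs : s ∈ Set.range cs.simple) : s * s = 1 := by
  obtain ⟨i, rfl⟩ := hs
  simp

theorem δp_self (x : Cp) : T.δp x x = 1 := (T.p_eq_one_iff x x).mpr rfl

theorem δp_simple_symm {y z : Cp} {s : W} (hs : s ∈ Set.range cs.simple) (h : T.δp y z = s) :
    T.δp z y = s := by
  obtain ⟨u, hu, hu'⟩ := T.p_three y z s hs
  rw [h, simple_mul_self_of_mem_range hs, T.p_eq_one_iff] at hu'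
  rwa [hu']

/-- Induction on a `J`-gallery from a chamber `y` to a chamber `z`. -/
theorem gallery_induction (hJ : J ⊆ Set.range cs.simple) {y z : Cp} {P : Cp → Prop}
    (h : T.δp y z ∈ Subgroup.closure J) (base : P y)
    (step : ∀ a b s, s ∈ J → T.δp a b = s → P a → P b) : P z := by
  generalize hw : T.δp y z = w at h
  have mul : ∀ w s, s ∈ J → (∀ z, T.δp y z = w → P z) → ∀ z, T.δp y z = w * s → P z := by
    intro w s hs ih z hz
    obtain ⟨u, hu, hu'⟩ := T.p_three y z s (hJ hs)
    rw [hz, mul_assoc, simple_mul_self_of_mem_range (hJ hs), mul_one] at hu'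
    exact step u z s hs (T.δp_simple_symm (hJ hs) hu) (ih u hu')
  induction h using Subgroup.closure_induction_right generalizing z with
  | one => rwa [← (T.p_eq_one_iff y z).mp hw]
  | mul_right w _ s hs ih => exact mul w s hs (fun z hz => ih hz) z hw
  | mul_inv_cancel w _ s hs ih =>
    rw [inv_eq_of_mul_eq_one_right (simple_mul_self_of_mem_range (hJ hs))] at hw
    exact mul w s hs (fun z hz => ih hz) z hw

theorem δp_mem_trans (hJ : J ⊆ Set.range cs.simple) {x y z : Cp}
    (hxy : T.δp x y ∈ Subgroup.closure J) (hyz : T.δp y z ∈ Subgroup.closure J) :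
    T.δp x z ∈ Subgroup.closure J := by
  refine T.gallery_induction hJ (P := fun a => T.δp x a ∈ Subgroup.closure J) hyz hxy
    fun a b s hs hab ha => ?_
  obtain h | h := T.p_two x a b s (hJ hs) hab <;> rw [h]
  exacts [ha, mul_mem ha (Subgroup.subset_closure hs)]

theorem δp_mem_symm (hJ : J ⊆ Set.range cs.simple) {x y : Cp}
    (h : T.δp x y ∈ Subgroup.closure J) : T.δp y x ∈ Subgroup.closure J := by
  refine T.gallery_induction hJ (P := fun a => T.δp a x ∈ Subgroup.closure J) h
    (by rw [δp_self]; exact one_mem _) fun a b s hs hab ha => ?_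
  refine T.δp_mem_trans hJ ?_ ha
  rw [T.δp_simple_symm (hJ hs) hab]
  exact Subgroup.subset_closure hs

theorem residue_eq_of_mem (hJ : J ⊆ Set.range cs.simple) {c d : Cp} (h : d ∈ T.residue J c) :
    T.residue J c = T.residue J d :=
  Set.ext fun _ => ⟨T.δp_mem_trans hJ (T.δp_mem_symm hJ h), T.δp_mem_trans hJ h⟩

theorem δts_eq_or_of_adj {x : Cm} {y z : Cp} {s : W} (hs : s ∈ Set.range cs.simple)
    (h : T.δp y z = s) : T.δts x z = T.δts x y ∨ T.δts x z = T.δts x y * s := by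
  have hss := simple_mul_self_of_mem_range hs
  have hlen : cs.length (T.δts x y * s) = cs.length (T.δts x y) + 1 ∨
      cs.length (T.δts x y * s) + 1 = cs.length (T.δts x y) := by
    obtain ⟨i, rfl⟩ := hs
    exact cs.length_mul_simple _ i
  obtain hlen | hlen := hlen
  · obtain ⟨u, hu, hu'⟩ := T.tw3m x y s hs
    obtain huz | huz := T.p_two u y z s hs h
    · rw [T.δp_simple_symm hs hu] at huz
      left
      rw [T.tw2m x u z s hs huz (by rw [hu', mul_assoc, hss, mul_one, hlen]), hu', mul_assoc, hss,
        mul_one]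
    · rw [T.δp_simple_symm hs hu, hss, T.p_eq_one_iff] at huz
      exact .inr (huz ▸ hu')
  · exact .inr (T.tw2m x y z s hs h hlen)

theorem δts_mem_trans (hJ : J ⊆ Set.range cs.simple) {x : Cm} {y z : Cp}
    (hxy : T.δts x y ∈ Subgroup.closure J) (hyz : T.δp y z ∈ Subgroup.closure J) :
    T.δts x z ∈ Subgroup.closure J := by
  refine T.gallery_induction hJ (P := fun a => T.δts x a ∈ Subgroup.closure J) hyz hxy
    fun a b s hs hab ha => ?_
  obtain h | h := T.δts_eq_or_of_adj (x := x) (hJ hs) hab <;> rw [h]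
  exacts [ha, mul_mem ha (Subgroup.subset_closure hs)]

/-- If the codistance from `x` to `y` lies in `W_J`, then `x` is opposite a chamber of the
`J`-residue of `y`. -/
theorem exists_δts_eq_one (hJ : J ⊆ Set.range cs.simple) {x : Cm} {y : Cp}
    (h : T.δts x y ∈ Subgroup.closure J) :
    ∃ z, T.δp y z ∈ Subgroup.closure J ∧ T.δts x z = 1 := by
  generalize hw : T.δts x y = w at h
  have mul : ∀ w s, s ∈ J →
      (∀ y, T.δts x y = w → ∃ z, T.δp y z ∈ Subgroup.closure J ∧ T.δts x z = 1) →
      ∀ y, T.δts x y = w * s → ∃ z, T.δp y z ∈ Subgroup.closure J ∧ T.δts x z = 1 := by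
    intro w s hs ih y hy
    obtain ⟨u, hu, hu'⟩ := T.tw3m x y s (hJ hs)
    rw [hy, mul_assoc, simple_mul_self_of_mem_range (hJ hs), mul_one] at hu'
    obtain ⟨z, hz, hz'⟩ := ih u hu'
    exact ⟨z, T.δp_mem_trans hJ (hu ▸ Subgroup.subset_closure hs) hz, hz'⟩
  induction h using Subgroup.closure_induction_right generalizing y with
  | one => exact ⟨y, by rw [δp_self]; exact one_mem _, hw⟩
  | mul_right w _ s hs ih => exact mul w s hs (fun y hy => ih hy) y hw
  | mul_inv_cancel w _ s hs ih =>
    rw [inv_eq_of_mul_eq_one_right (simple_mul_self_of_mem_range (hJ hs))] at hw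
    exact mul w s hs (fun y hy => ih hy) y hw

variable {T} {R : Set Cp}

theorem IsPhan.eq_residue (hJ : J ⊆ Set.range cs.simple) (h : T.IsPhan J R) {c : Cp}
    (hc : c ∈ R) : R = T.residue J c := by
  obtain ⟨⟨d, rfl⟩, -⟩ := h
  exact T.residue_eq_of_mem hJ hc

/-- The parabolic subgroup of the type of a Phan residue is stable under the automorphism of `W`
induced by the quasi-flip. -/
theorem IsPhan.π_mem (hJ : J ⊆ Set.range cs.simple) (h : T.IsPhan J R) (hR : R.Nonempty) {w : W}
    (hw : w ∈ Subgroup.closure J) : T.π w ∈ Subgroup.closure J := by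
  suffices Subgroup.closure J ≤ (Subgroup.closure J).comap T.π.toMonoidHom from this hw
  rw [Subgroup.closure_le]
  intro s hs
  change T.π s ∈ Subgroup.closure J
  obtain ⟨r, hr⟩ := hR
  obtain ⟨r', hr', hopp⟩ := h.2.1 r hr
  have hπs : T.π s ∈ Set.range cs.simple := T.πS ▸ Set.mem_image_of_mem _ (hJ hs)
  obtain ⟨z, hz, hz'⟩ := T.tw3p r (T.θp r') (T.π s) hπs
  rw [show T.δst r (T.θp r') = 1 from hopp, one_mul] at hz'
  have hzR : T.θm z ∈ R := by
    rw [h.eq_residue hJ hr']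
    change T.δp r' (T.θm z) ∈ Subgroup.closure J
    rw [← T.θmθp r', T.flip_m, hz, T.ππ]
    exact Subgroup.subset_closure hs
  obtain ⟨q, hq, hqz⟩ := h.2.2 _ hzR
  rw [Opp, T.θpθm] at hqz
  have hqr : T.δp q r ∈ Subgroup.closure J := by
    rw [h.eq_residue hJ hq] at hr
    exact hr
  have := T.δts_mem_trans hJ (x := z) (by rw [T.tw1, hqz, inv_one]; exact one_mem _) hqr
  rwa [T.tw1, hz', inv_mem_iff] at this

theorem IsPhan.δθ_mem (hJ : J ⊆ Set.range cs.simple) (h : T.IsPhan J R) {r : Cp} (hr : r ∈ R) :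
    T.δθ r ∈ Subgroup.closure J := by
  obtain ⟨r', hr', hopp⟩ := h.2.1 r hr
  have hdist : T.δm (T.θp r') (T.θp r) ∈ Subgroup.closure J := by
    rw [T.flip_p]
    rw [h.eq_residue hJ hr'] at hr
    exact h.π_mem hJ ⟨r', hr'⟩ hr
  refine T.swap.δts_mem_trans hJ (x := r) ?_ hdist
  change T.δst r (T.θp r') ∈ Subgroup.closure J
  rw [show T.δst r (T.θp r') = 1 from hopp]
  exact one_mem _

/-- A `J`-residue is a Phan residue if `W_J` is stable under the automorphism induced by the
quasi-flip and contains the `θ`-codistances of its chambers. -/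
theorem isPhan_residue (hJ : J ⊆ Set.range cs.simple)
    (hπ : ∀ w ∈ Subgroup.closure J, T.π w ∈ Subgroup.closure J) {c : Cp}
    (hθ : ∀ r ∈ T.residue J c, T.δθ r ∈ Subgroup.closure J) : T.IsPhan J (T.residue J c) := by
  refine ⟨⟨c, rfl⟩, fun r hr => ?_, fun r hr => ?_⟩
  · obtain ⟨z, hz, hz'⟩ := T.swap.exists_δts_eq_one hJ (x := r) (y := T.θp r) (hθ r hr)
    refine ⟨T.θm z, T.δp_mem_trans hJ hr ?_, ?_⟩
    · rw [← T.θmθp r, T.flip_m]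
      exact hπ _ hz
    · rw [Opp, T.θpθm]
      exact hz'
  · obtain ⟨z, hz, hz'⟩ := T.exists_δts_eq_one hJ (x := T.θp r) (y := r)
      (by rw [T.tw1]; exact inv_mem (hθ r hr))
    refine ⟨z, T.δp_mem_trans hJ hr hz, ?_⟩
    rwa [T.tw1, inv_eq_one] at hz'

end QuasiFlipTwinBuilding

open QuasiFlipTwinBuilding in
/-- If `R₁` and `R₂` are Phan residues of types `I₁` and `I₂` with nonempty intersection,
then `R₁ ∩ R₂` is a Phan residue of type `I₁ ∩ I₂`. -/
theorem isPhan_inter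
    {B : Type*} {W : Type*} [Group W] {M : CoxeterMatrix B} {cs : CoxeterSystem M W}
    {Cp : Type u} {Cm : Type v} (T : QuasiFlipTwinBuilding M cs Cp Cm)
    (I₁ I₂ : Set W) (hI₁ : I₁ ⊆ Set.range cs.simple) (hI₂ : I₂ ⊆ Set.range cs.simple)
    (R₁ R₂ : Set Cp) (h₁ : T.IsPhan I₁ R₁) (h₂ : T.IsPhan I₂ R₂)
    (hne : (R₁ ∩ R₂).Nonempty) :
    T.IsPhan (I₁ ∩ I₂) (R₁ ∩ R₂) := by
  obtain ⟨c, hc₁, hc₂⟩ := hne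
  have hcl := CoxeterSystem.closure_inter hI₁ hI₂
  have hres : R₁ ∩ R₂ = T.residue (I₁ ∩ I₂) c := by
    rw [h₁.eq_residue hI₁ hc₁, h₂.eq_residue hI₂ hc₂]
    ext d
    simp only [residue, Set.mem_inter_iff, Set.mem_ofPred_eq, hcl, Subgroup.mem_inf]
  rw [hres]
  refine isPhan_residue (Set.inter_subset_left.trans hI₁) (fun w hw => ?_) (fun r hr => ?_)
  · rw [hcl] at hw ⊢
    exact ⟨h₁.π_mem hI₁ ⟨c, hc₁⟩ hw.1, h₂.π_mem hI₂ ⟨c, hc₂⟩ hw.2⟩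
  · rw [← hres] at hr
    rw [hcl]
    exact ⟨h₁.δθ_mem hI₁ hr.1, h₂.δθ_mem hI₂ hr.2⟩
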